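/- Let √3 denote the real square root of 3 and define h : ℂ → ℂ by h(z) = 64(135 + 78√3)(z−1)³ / ((z − 4 − 2√3)³ · (3z + 2√3)³) wherever the denominator is nonzero. Then h(0) = 1, h(8 + 4√3) = 1, and for every z ∈ ℂ with z − 4 − 2√3 ≠ 0 and 3z + 2√3 ≠ 0, if deriv h z = 0 then h(z) = 0 or h(z) = 1. -/

import Mathlib

/-- The Belyi function h(z) = 64(135+78√3)(z−1)³/((z−4−2√3)³(3z+2√3)³) of Example 3. -/
noncomputable def belyiTwoThirds : ℂ → ℂ :=
  fun z => 64 * (135 + 78 * (Real.sqrt 3 : ℂ)) * (z - 1) ^ 3 /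
    ((z - 4 - 2 * (Real.sqrt 3 : ℂ)) ^ 3 * (3 * z + 2 * (Real.sqrt 3 : ℂ)) ^ 3)

lemma ofReal_sqrt_three_sq : (Real.sqrt 3 : ℂ) ^ 2 = 3 := by
  rw [← Complex.ofReal_pow, Real.sq_sqrt (by norm_num)]
  norm_num

lemma hasDerivAt_belyiTwoThirds {z : ℂ} (h₁ : z - 4 - 2 * (Real.sqrt 3 : ℂ) ≠ 0)
    (h₂ : 3 * z + 2 * (Real.sqrt 3 : ℂ) ≠ 0) :
    HasDerivAt belyiTwoThirds
      (576 * (135 + 78 * (Real.sqrt 3 : ℂ)) * (z - 1) ^ 2 *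
        -(z ^ 2 - 2 * z + 8 + 4 * (Real.sqrt 3 : ℂ)) /
        ((z - 4 - 2 * (Real.sqrt 3 : ℂ)) ^ 4 * (3 * z + 2 * (Real.sqrt 3 : ℂ)) ^ 4)) z := by
  have ht := ofReal_sqrt_three_sq
  unfold belyiTwoThirds
  generalize (Real.sqrt 3 : ℂ) = t at *
  have hw : HasDerivAt (fun z : ℂ => z - 1) 1 z := (hasDerivAt_id z).sub_const 1
  have ha : HasDerivAt (fun z : ℂ => z - 4 - 2 * t) 1 z :=
    ((hasDerivAt_id z).sub_const 4).sub_const (2 * t)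
  have hb : HasDerivAt (fun z : ℂ => 3 * z + 2 * t) (3 * 1) z :=
    ((hasDerivAt_id z).const_mul 3).add_const (2 * t)
  refine (((hw.pow 3).const_mul (64 * (135 + 78 * t))).div ((ha.pow 3).mul (hb.pow 3))
    (mul_ne_zero (pow_ne_zero 3 h₁) (pow_ne_zero 3 h₂))).congr_deriv ?_
  have key : -(z ^ 2 - 2 * z + 8 + 4 * t) =
      ((z - 4 - 2 * t) * (3 * z + 2 * t) -
        (z - 1) * ((3 * z + 2 * t) + 3 * (z - 4 - 2 * t))) / 3 := by
    linear_combination (4 / 3) * ht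
  rw [key]
  simp only [Pi.mul_apply, Pi.pow_apply]
  generalize z - 4 - 2 * t = a at *
  generalize 3 * z + 2 * t = b at *
  field_simp
  ring

lemma belyiTwoThirds_eq_one_of_sq {z : ℂ} (h₁ : z - 4 - 2 * (Real.sqrt 3 : ℂ) ≠ 0)
    (h₂ : 3 * z + 2 * (Real.sqrt 3 : ℂ) ≠ 0)
    (hz : z ^ 2 - 2 * z + 8 + 4 * (Real.sqrt 3 : ℂ) = 0) : belyiTwoThirds z = 1 := by
  have ht := ofReal_sqrt_three_sq
  unfold belyiTwoThirds
  generalize (Real.sqrt 3 : ℂ) = t at *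
  rw [div_eq_one_iff_eq (mul_ne_zero (pow_ne_zero 3 h₁) (pow_ne_zero 3 h₂)), ← mul_pow]
  have hD : (z - 4 - 2 * t) * (3 * z + 2 * t) = (z - 1) * (6 * (z - 1) - (6 + 4 * t)) := by
    linear_combination -3 * hz - 4 * ht
  have hu : (6 * (z - 1) - (6 + 4 * t)) ^ 3 = 64 * (135 + 78 * t) := by
    linear_combination (216 * (z - 1) - 108 * (6 + 4 * t)) * hz +
      (288 * (z - 1) + 1440 - 64 * t) * ht
  rw [hD, mul_pow, hu, mul_comm]

/-- h(0) = 1, h(8+4√3) = 1, and every finite critical point of h (away from the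
poles) has critical value 0 or 1. -/
theorem belyiTwoThirds_conditions :
    belyiTwoThirds 0 = 1 ∧
    belyiTwoThirds (8 + 4 * (Real.sqrt 3 : ℂ)) = 1 ∧
    ∀ z : ℂ, z - 4 - 2 * (Real.sqrt 3 : ℂ) ≠ 0 → 3 * z + 2 * (Real.sqrt 3 : ℂ) ≠ 0 →
      deriv belyiTwoThirds z = 0 →
      belyiTwoThirds z = 0 ∨ belyiTwoThirds z = 1 := by
  have ht := ofReal_sqrt_three_sq
  refine ⟨?_, ?_, fun z h₁ h₂ hd => ?_⟩
  · unfold belyiTwoThirds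
    generalize (Real.sqrt 3 : ℂ) = t at *
    have h₁ : (0 : ℂ) - 4 - 2 * t ≠ 0 := by grind
    have h₂ : (3 : ℂ) * 0 + 2 * t ≠ 0 := by grind
    rw [div_eq_one_iff_eq (mul_ne_zero (pow_ne_zero 3 h₁) (pow_ne_zero 3 h₂))]
    grind
  · unfold belyiTwoThirds
    generalize (Real.sqrt 3 : ℂ) = t at *
    have h₁ : 8 + 4 * t - 4 - 2 * t ≠ 0 := by grind
    have h₂ : 3 * (8 + 4 * t) + 2 * t ≠ 0 := by grind
    rw [div_eq_one_iff_eq (mul_ne_zero (pow_ne_zero 3 h₁) (pow_ne_zero 3 h₂))]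
    grind
  · rw [(hasDerivAt_belyiTwoThirds h₁ h₂).deriv,
      div_eq_zero_iff, or_iff_left (mul_ne_zero (pow_ne_zero 4 h₁) (pow_ne_zero 4 h₂))] at hd
    have hK : 576 * (135 + 78 * (Real.sqrt 3 : ℂ)) ≠ 0 := by
      generalize (Real.sqrt 3 : ℂ) = t at *
      grind
    rcases mul_eq_zero.mp hd with hw | hq
    · left
      have hz : z - 1 = 0 := pow_eq_zero_iff two_ne_zero |>.mp ((mul_eq_zero.mp hw).resolve_left hK)
      simp [belyiTwoThirds, hz]
    · exact .inr (belyiTwoThirds_eq_one_of_sq h₁ h₂ (neg_eq_zero.mp hq))
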